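/- Let f, g ∈ H^∞(𝔹). Then f * g is cyclic in H²(𝔹) if and only if both f and g are cyclic in H²(𝔹). -/

import Mathlib

open MeasureTheory Filter Topology
open scoped ENNReal Classical

noncomputable section

/-! ### Basic quaternionic notions -/

instance : MeasurableSpace (Quaternion ℝ) := borel _
instance : BorelSpace (Quaternion ℝ) := ⟨rfl⟩

/-- The 2-sphere `𝕊` of quaternionic imaginary units. -/
def USphere : Set (Quaternion ℝ) := {q | q ^ 2 = -1}

/-- The open quaternionic unit ball `𝔹`. -/
def QBall : Set (Quaternion ℝ) := {q | ‖q‖ < 1}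

/-- The slice `L_I = ℝ + ℝI` through an imaginary unit `I`. -/
def sliceSet (I : Quaternion ℝ) : Set (Quaternion ℝ) :=
  {q | ∃ x y : ℝ, q = (x : Quaternion ℝ) + y • I}

/-- The point `e^{tI} = cos t + (sin t) I` of the boundary circle `∂𝔹_I`. -/
def ptOn (I : Quaternion ℝ) (t : ℝ) : Quaternion ℝ :=
  ((Real.cos t : ℝ) : Quaternion ℝ) + Real.sin t • I

/-- Slice regularity on the unit ball: on every slice the restriction of `f` has partial
derivatives satisfying the Cauchy–Riemann equation `∂f/∂x + I ∂f/∂y = 0`. -/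
def SliceRegular (f : Quaternion ℝ → Quaternion ℝ) : Prop :=
  ∀ I ∈ USphere, ∀ x y : ℝ, ((x : Quaternion ℝ) + y • I) ∈ QBall →
    ∃ fx fy : Quaternion ℝ,
      HasDerivAt (fun s : ℝ => f ((s : Quaternion ℝ) + y • I)) fx x ∧
      HasDerivAt (fun t : ℝ => f ((x : Quaternion ℝ) + t • I)) fy y ∧
      fx + I * fy = 0

/-! ### The Hardy space `H²(𝔹)` via power series coefficients.
A slice regular function on `𝔹` is identified with its coefficient sequence
`a : ℕ → ℍ`, the function being `q ↦ ∑ qⁿ aₙ`. -/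

/-- Membership in `H²(𝔹)`: square-summable coefficients. -/
def MemH2 (a : ℕ → Quaternion ℝ) : Prop := Summable (fun n => ‖a n‖ ^ 2)

/-- Evaluation of the power series `q ↦ ∑ qⁿ aₙ`. -/
def evalS (a : ℕ → Quaternion ℝ) (q : Quaternion ℝ) : Quaternion ℝ := ∑' n, q ^ n * a n

/-- The `*`-product (slice product) on coefficient sequences. -/
def sProd (a b : ℕ → Quaternion ℝ) : ℕ → Quaternion ℝ :=
  fun n => ∑ k ∈ Finset.range (n + 1), a k * b (n - k)

/-- The regular conjugate `fᶜ`. -/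
def conjS (a : ℕ → Quaternion ℝ) : ℕ → Quaternion ℝ := fun n => star (a n)

/-- The symmetrization `fˢ = f * fᶜ`. -/
def symmS (a : ℕ → Quaternion ℝ) : ℕ → Quaternion ℝ := sProd a (conjS a)

/-- The squared `H²` norm `∑ ‖aₙ‖²`. -/
def h2normSq (a : ℕ → Quaternion ℝ) : ℝ := ∑' n, ‖a n‖ ^ 2

/-- The `H²` norm. -/
def h2norm (a : ℕ → Quaternion ℝ) : ℝ := Real.sqrt (h2normSq a)

/-- The (right) quaternionic inner product `⟨f,g⟩ = ∑ conj(bₙ) aₙ` of `H²(𝔹)`. -/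
def h2inner (a b : ℕ → Quaternion ℝ) : Quaternion ℝ := ∑' n, star (b n) * a n

/-- Squared `H²`-distance of two coefficient sequences (valued in `ℝ≥0∞`). -/
def h2distSq (a b : ℕ → Quaternion ℝ) : ℝ≥0∞ := ∑' n, (‖a n - b n‖₊ : ℝ≥0∞) ^ 2

/-- The boundary value function of `f ∈ H²(𝔹)`, given by the radial limit where it exists. -/
def bdval (a : ℕ → Quaternion ℝ) (q : Quaternion ℝ) : Quaternion ℝ :=
  if h : ∃ L, Tendsto (fun r : ℝ => evalS a ((r : Quaternion ℝ) * q)) (𝓝[<] (1 : ℝ)) (𝓝 L)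
  then h.choose else 0

/-! ### The measure `Σ` on `∂𝔹` with `dΣ(e^{tI}) = dσ(I) dt`. -/

/-- The normalized area measure `σ` on the sphere `𝕊` of imaginary units
(2-dimensional Hausdorff measure, normalized so that `σ(𝕊) = 1`). -/
def sphMeasure : Measure (Quaternion ℝ) := (μH[2] USphere)⁻¹ • (μH[2]).restrict USphere

/-- The measure `Σ` on `∂𝔹`, `dΣ(e^{tI}) = dσ(I) dt`, normalized so `Σ(∂𝔹) = 1`. -/
def SigmaBd : Measure (Quaternion ℝ) :=
  (ENNReal.ofReal (2 * Real.pi))⁻¹ •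
    Measure.map (fun p : ℝ × Quaternion ℝ => ptOn p.2 p.1)
      ((volume.restrict (Set.Ico 0 (2 * Real.pi))).prod sphMeasure)

/-! ### Inner, outer, cyclic -/

/-- `f ∈ H^∞(𝔹)`: a bounded function of `H²(𝔹)`. -/
def MemHinf (a : ℕ → Quaternion ℝ) : Prop :=
  MemH2 a ∧ ∃ C : ℝ, ∀ q ∈ QBall, ‖evalS a q‖ ≤ C

/-- The `H^∞` norm: the sup of `‖f‖` on the ball. -/
def hInfNorm (a : ℕ → Quaternion ℝ) : ℝ := sSup ((fun q => ‖evalS a q‖) '' QBall)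

/-- `f` is inner: `f ∈ H^∞(𝔹)`, `‖f‖ ≤ 1` on `𝔹` and `‖f‖ = 1` `Σ`-a.e. on `∂𝔹`. -/
def IsInnerQ (a : ℕ → Quaternion ℝ) : Prop :=
  MemH2 a ∧ (∀ q ∈ QBall, ‖evalS a q‖ ≤ 1) ∧ (∀ᵐ q ∂SigmaBd, ‖bdval a q‖ = 1)

/-- `g` is outer: whenever `f ∈ H²(𝔹)` has the same boundary modulus `Σ`-a.e.,
then `‖g‖ ≥ ‖f‖` throughout `𝔹`. -/
def IsOuterQ (g : ℕ → Quaternion ℝ) : Prop :=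
  MemH2 g ∧ ∀ f, MemH2 f → (∀ᵐ q ∂SigmaBd, ‖bdval g q‖ = ‖bdval f q‖) →
    ∀ q ∈ QBall, ‖evalS f q‖ ≤ ‖evalS g q‖

/-- Quaternionic polynomials (finitely supported coefficient sequences). -/
def IsPolyQ (p : ℕ → Quaternion ℝ) : Prop := ∃ N, ∀ n > N, p n = 0

/-- Quaternionic polynomials of degree at most `n` (the space `𝒫_n`). -/
def IsPolyDeg (p : ℕ → Quaternion ℝ) (n : ℕ) : Prop := ∀ m > n, p m = 0

/-- The coefficient sequence of the monomial `qᵏ`. -/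
def qpow (k : ℕ) : ℕ → Quaternion ℝ := fun n => if n = k then 1 else 0

/-- The coefficient sequence of a constant function. -/
def constS (c : Quaternion ℝ) : ℕ → Quaternion ℝ := fun n => if n = 0 then c else 0

/-- The coefficient sequence of the constant function `1`. -/
def oneS : ℕ → Quaternion ℝ := constS 1

/-- The invariant subspace `[g]`: the `H²`-closure of `{g * p : p polynomial}`,
i.e. of the right span of `{qⁿ * g : n ≥ 0}`. -/
def InvSub (g : ℕ → Quaternion ℝ) : Set (ℕ → Quaternion ℝ) :=
  {h | MemH2 h ∧ ∀ ε : ℝ≥0∞, 0 < ε → ∃ p, IsPolyQ p ∧ h2distSq (sProd g p) h < ε}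

/-- `g` is cyclic: `[g] = H²(𝔹)`. -/
def IsCyclicQ (g : ℕ → Quaternion ℝ) : Prop :=
  MemH2 g ∧ ∀ h, MemH2 h → h ∈ InvSub g

/-! ### Bilateral (slice `L²`) series, used for boundary products -/

/-- Bilateral coefficients of `f̃(q) = f(q̄)` on `∂𝔹`: `Σ_{n ≤ 0} qⁿ a_{-n}`. -/
def tildeZ (a : ℕ → Quaternion ℝ) : ℤ → Quaternion ℝ :=
  fun k => if k ≤ 0 then a (-k).toNat else 0

/-- Bilateral coefficients of `fᶜ` on `∂𝔹`. -/
def conjZ (a : ℕ → Quaternion ℝ) : ℤ → Quaternion ℝ :=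
  fun k => if 0 ≤ k then star (a k.toNat) else 0

/-- The `*`-product of two slice `L²` functions on the boundary, on coefficients. -/
def convZ (c b : ℤ → Quaternion ℝ) : ℤ → Quaternion ℝ := fun n => ∑' k : ℤ, c k * b (n - k)

/-- Evaluation of a bilateral series `q ↦ ∑_{n ∈ ℤ} qⁿ dₙ`. -/
def evalZ (d : ℤ → Quaternion ℝ) (q : Quaternion ℝ) : Quaternion ℝ := ∑' n : ℤ, q ^ n * d n

/-- The slice inner product `⟨qᵏ * f, f⟩_I = (1/2π)∫₀^{2π} conj(f(e^{θI})) (e^{θI})ᵏ f(e^{θI}) dθ`,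
computed with boundary values; note `(qᵏ * f)(q) = qᵏ f(q)` pointwise. -/
def sliceInnerPow (a : ℕ → Quaternion ℝ) (I : Quaternion ℝ) (k : ℕ) : Quaternion ℝ :=
  (2 * Real.pi)⁻¹ •
    ∫ t in Set.Ico 0 (2 * Real.pi), star (bdval a (ptOn I t)) * ((ptOn I t) ^ k * bdval a (ptOn I t))

/-! ### Complex Hardy space `H²(𝔻)` notions (for slice restrictions) -/

/-- Membership in the complex Hardy space `H²(𝔻)` via coefficients. -/
def CMemH2 (c : ℕ → ℂ) : Prop := Summable (fun n => ‖c n‖ ^ 2)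

/-- Evaluation of a complex power series. -/
def cEval (c : ℕ → ℂ) (z : ℂ) : ℂ := ∑' n, z ^ n * c n

/-- Cauchy product of complex coefficient sequences. -/
def cConv (c d : ℕ → ℂ) : ℕ → ℂ := fun n => ∑ k ∈ Finset.range (n + 1), c k * d (n - k)

/-- Squared `H²(𝔻)` distance. -/
def cDistSq (c d : ℕ → ℂ) : ℝ≥0∞ := ∑' n, (‖c n - d n‖₊ : ℝ≥0∞) ^ 2

/-- Radial boundary values of a complex `H²` function. -/
def cBdval (c : ℕ → ℂ) (z : ℂ) : ℂ :=
  if h : ∃ L, Tendsto (fun r : ℝ => cEval c ((r : ℂ) * z)) (𝓝[<] (1 : ℝ)) (𝓝 L)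
  then h.choose else 0

/-- Lebesgue measure on the unit circle `∂𝔻` (parametrized by `θ ∈ [0, 2π)`). -/
def circleM : Measure ℂ :=
  Measure.map (fun t : ℝ => Complex.exp (t * Complex.I)) (volume.restrict (Set.Ico 0 (2 * Real.pi)))

/-- Cyclicity in `H²(𝔻)`: polynomial multiples of `c` are dense. -/
def CIsCyclic (c : ℕ → ℂ) : Prop :=
  CMemH2 c ∧ ∀ h, CMemH2 h → ∀ ε : ℝ≥0∞, 0 < ε →
    ∃ p : ℕ → ℂ, (∃ N, ∀ n > N, p n = 0) ∧ cDistSq (cConv c p) h < ε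

/-- Outerness in `H²(𝔻)` (in the sense matching Definition 2.10 of the paper). -/
def CIsOuter (c : ℕ → ℂ) : Prop :=
  CMemH2 c ∧ ∀ h, CMemH2 h →
    (∀ᵐ z ∂circleM, ‖cBdval c z‖ = ‖cBdval h z‖) →
    ∀ z ∈ Metric.ball (0 : ℂ) 1, ‖cEval h z‖ ≤ ‖cEval c z‖

/-- Complex coordinates of a point of the slice `L_I`: if `p = x + yI` then
`sliceToC I p = x + iy`. -/
def sliceToC (I : Quaternion ℝ) (p : Quaternion ℝ) : ℂ := ⟨p.re, -(p * I).re⟩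

/-- The quaternion `i`. -/
def qI : Quaternion ℝ := ⟨0, 1, 0, 0⟩

/-- The embedding of `ℂ = L_i` into the quaternions. -/
def cToQ (z : ℂ) : Quaternion ℝ := (z.re : Quaternion ℝ) + z.im • qI

/-- The imaginary unit `I_ω` identified by `ω` (any imaginary unit if `ω` is real). -/
def Iu (ω : Quaternion ℝ) : Quaternion ℝ := if ω.im = 0 then qI else ‖ω.im‖⁻¹ • ω.im

/-! ### Optimal approximants -/

/-- `p` is an optimal approximant of degree `n` of `f^{-*}`: `p ∈ 𝒫_n` minimizes
`‖f * p - 1‖_{H²}` among all `p ∈ 𝒫_n`. -/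
def IsOptApprox (a : ℕ → Quaternion ℝ) (n : ℕ) (p : ℕ → Quaternion ℝ) : Prop :=
  IsPolyDeg p n ∧ ∀ r, IsPolyDeg r n → h2distSq (sProd a p) oneS ≤ h2distSq (sProd a r) oneS

end

section Hil
variable {H : Type*} [NormedAddCommGroup H] [InnerProductSpace ℝ H]

lemma hil_iter (S : H →ₗᵢ[ℝ] H) (n : ℕ) (a b : H) :
    inner ℝ (S^[n] a) (S^[n] b) = inner ℝ a b := by
  induction n with
  | zero => rfl
  | succ n ih => rw [Function.iterate_succ_apply', Function.iterate_succ_apply', S.inner_map_map, ih]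

lemma hil_orth (S : H →ₗᵢ[ℝ] H) (y : H) (hy : ∀ n : ℕ, inner ℝ (S^[n+1] y) y = (0:ℝ)) (i j : ℕ)
    (hij : i ≠ j) : inner ℝ (S^[i] y) (S^[j] y) = (0:ℝ) := by
  wlog h : i < j generalizing i j
  · rw [real_inner_comm]; exact this j i hij.symm (by omega)
  obtain ⟨k, rfl⟩ := Nat.exists_eq_add_of_lt h
  rw [show i + k + 1 = i + (k+1) by ring, Function.iterate_add_apply, hil_iter, real_inner_comm]
  exact hy k

lemma hil_norm (S : H →ₗᵢ[ℝ] H) (y : H) (hy : ∀ n : ℕ, inner ℝ (S^[n+1] y) y = (0:ℝ))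
    (x : ℕ → ℝ) (s : Finset ℕ) (N : ℕ) (hN : ∀ j ∈ s, j ≤ N) :
    ‖∑ j ∈ s, x j • S^[N-j] y‖ ^ 2 = (∑ j ∈ s, x j ^ 2) * ‖y‖ ^ 2 := by
  rw [← real_inner_self_eq_norm_sq, sum_inner, Finset.sum_mul]
  refine Finset.sum_congr rfl fun i hi => ?_
  rw [inner_sum, Finset.sum_eq_single i]
  · rw [inner_smul_left, inner_smul_right, hil_iter, real_inner_self_eq_norm_sq]
    simp; ring
  · intro j hj hji
    rw [inner_smul_left, inner_smul_right, hil_orth S y hy]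
    · simp
    · have := hN i hi; have := hN j hj; omega
  · exact fun h => absurd hi h

lemma hil_bound (S : H →ₗᵢ[ℝ] H) (y : H) (hy : ∀ n : ℕ, inner ℝ (S^[n+1] y) y = (0:ℝ))
    (x : ℕ → ℝ) (d q : H) (hq : HasSum (fun j => x j • S^[j] d) q)
    (hx : ∀ s : Finset ℕ, ∑ j ∈ s, x j ^ 2 ≤ ‖d‖ ^ 2) :
    |inner ℝ q y| ≤ ‖d‖ ^ 2 * ‖y‖ := by
  have h1 : Tendsto (fun s : Finset ℕ => |inner ℝ (∑ j ∈ s, x j • S^[j] d) y|) atTop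
      (𝓝 |inner ℝ q y|) := by
    have : Continuous fun z : H => |inner ℝ z y| := by fun_prop
    exact (this.tendsto q).comp hq
  refine le_of_tendsto h1 (Eventually.of_forall fun s => ?_)
  set N := s.sup id
  have hN : ∀ j ∈ s, j ≤ N := fun j hj => Finset.le_sup (f := id) hj
  have e : inner ℝ (∑ j ∈ s, x j • S^[j] d) y
      = inner ℝ (S^[N] d) (∑ j ∈ s, x j • S^[N-j] y) := by
    rw [sum_inner, inner_sum]
    refine Finset.sum_congr rfl fun j hj => ?_
    rw [inner_smul_left, inner_smul_right]
    congr 1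
    conv_rhs => rw [← Nat.sub_add_cancel (hN j hj), Function.iterate_add_apply]
    rw [Nat.add_sub_cancel, hil_iter]
  rw [e]
  refine (abs_real_inner_le_norm _ _).trans ?_
  have h2 : ‖S^[N] d‖ = ‖d‖ := by
    have := hil_iter S N d d
    rw [real_inner_self_eq_norm_sq, real_inner_self_eq_norm_sq] at this
    exact (sq_eq_sq₀ (norm_nonneg _) (norm_nonneg _)).1 this
  have h3 : ‖∑ j ∈ s, x j • S^[N-j] y‖ ≤ ‖d‖ * ‖y‖ := by
    refine le_of_sq_le_sq ?_ (by positivity)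
    rw [hil_norm S y hy x s N hN, mul_pow]
    gcongr
    exact hx s
  rw [h2, sq, mul_assoc]
  gcongr

/-- abstract Hilbert space argument -/
lemma hil_main [CompleteSpace H] (S : H →ₗᵢ[ℝ] H) (e0 : H)
    (he : ∀ x, inner ℝ (S x) e0 = (0:ℝ)) (φ : H) (M : Submodule ℝ H)
    (hM : M = (Submodule.span ℝ (Set.range fun j : ℕ => S^[j] φ)).topologicalClosure)
    (hyp : ∀ ε > (0:ℝ), ∃ u ∈ M, ∃ d q : Fin 4 → H, ∃ x : Fin 4 → ℕ → ℝ,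
      (∀ i, ‖d i‖ < ε) ∧ (∀ i, HasSum (fun j => x i j • S^[j] (d i)) (q i)) ∧
      (∀ i, ∀ s : Finset ℕ, ∑ j ∈ s, x i j ^ 2 ≤ ‖d i‖ ^ 2) ∧
      u = e0 + (2:ℝ) • d 0 + ∑ i, q i) : e0 ∈ M := by
  have hMc : IsClosed (M : Set H) := by rw [hM]; exact Submodule.isClosed_topologicalClosure _
  have : CompleteSpace M := hMc.completeSpace_coe
  have hS : ∀ x ∈ M, S x ∈ M := by
    intro x hx
    rw [hM] at hx ⊢
    refine map_mem_closure S.continuous hx ?_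
    intro y hy
    induction hy using Submodule.span_induction with
    | mem y h =>
      obtain ⟨j, rfl⟩ := h
      refine Submodule.subset_span ⟨j+1, ?_⟩
      simp [Function.iterate_succ_apply']
    | zero => simp
    | add y z _ _ h1 h2 => rw [map_add]; exact Submodule.add_mem _ h1 h2
    | smul c y _ h => rw [map_smul]; exact Submodule.smul_mem _ c h
  have hSn : ∀ n, ∀ x ∈ M, S^[n] x ∈ M := by
    intro n x hx
    induction n with
    | zero => exact hx
    | succ n ih => rw [Function.iterate_succ_apply']; exact hS _ ih
  obtain ⟨w, hw, hv⟩ : ∃ w ∈ M, ∀ z ∈ M, inner ℝ z (e0 - w) = (0:ℝ) := by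
    refine ⟨M.starProjection e0, Submodule.starProjection_apply_mem _ _, ?_⟩
    intro z hz
    exact Submodule.inner_right_of_mem_orthogonal hz (Submodule.sub_starProjection_mem_orthogonal e0)
  have hww : ∀ n : ℕ, inner ℝ (S^[n+1] w) w = (0:ℝ) := by
    intro n
    have := hv _ (hSn (n+1) w hw)
    rw [inner_sub_right, Function.iterate_succ_apply', he] at this
    rw [Function.iterate_succ_apply']
    linarith
  have hee : ∀ n : ℕ, inner ℝ (S^[n+1] e0) e0 = (0:ℝ) := by
    intro n
    rw [Function.iterate_succ_apply', he]
  set v := e0 - w with hvdef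
  have key : ∀ ε > (0:ℝ), |inner ℝ e0 v| ≤ 2 * ε * ‖v‖ + 4 * (ε ^ 2 * (‖e0‖ + ‖w‖)) := by
    intro ε hε
    obtain ⟨u, hu, d, q, x, hd, hq, hx, rfl⟩ := hyp ε hε
    have h0 := hv _ hu
    rw [inner_add_left, inner_add_left, inner_smul_left, sum_inner] at h0
    have hqi : ∀ i, |inner ℝ (q i) v| ≤ ε ^ 2 * (‖e0‖ + ‖w‖) := by
      intro i
      have h1 := hil_bound S e0 hee _ _ _ (hq i) (hx i)
      have h2 := hil_bound S w hww _ _ _ (hq i) (hx i)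
      have h3 : ‖d i‖ ^ 2 ≤ ε ^ 2 := by have := (hd i).le; gcongr
      rw [hvdef, inner_sub_right]
      refine (abs_sub _ _).trans ?_
      nlinarith [norm_nonneg e0, norm_nonneg w]
    have hs : |∑ i, inner ℝ (q i) v| ≤ 4 * (ε ^ 2 * (‖e0‖ + ‖w‖)) := by
      refine (Finset.abs_sum_le_sum_abs _ _).trans ?_
      refine (Finset.sum_le_sum fun i _ => hqi i).trans ?_
      simp
    have hd0 : |inner ℝ (d 0) v| ≤ ε * ‖v‖ := by
      refine (abs_real_inner_le_norm _ _).trans ?_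
      have := (hd 0).le
      gcongr
    simp only [conj_trivial] at h0
    rw [abs_le] at hs hd0 ⊢
    constructor <;> linarith
  have hz : |inner ℝ e0 v| ≤ 0 := by
    have ht : Tendsto (fun ε : ℝ => 2 * ε * ‖v‖ + 4 * (ε ^ 2 * (‖e0‖ + ‖w‖))) (𝓝[>] 0) (𝓝 0) := by
      have : Continuous (fun ε : ℝ => 2 * ε * ‖v‖ + 4 * (ε ^ 2 * (‖e0‖ + ‖w‖))) := by fun_prop
      have := this.tendsto 0
      simp at this
      exact this.mono_left nhdsWithin_le_nhds
    refine ge_of_tendsto ht ?_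
    filter_upwards [self_mem_nhdsWithin] with ε hε using key ε hε
  have h1 : inner ℝ e0 v = (0:ℝ) := abs_eq_zero.1 (le_antisymm hz (abs_nonneg _))
  have h2 : inner ℝ v v = (0:ℝ) := by
    conv_lhs => rw [hvdef]
    rw [← hvdef, inner_sub_left, h1, hv w hw, sub_zero]
  have h3 : v = 0 := inner_self_eq_zero.1 h2
  rw [hvdef, sub_eq_zero] at h3
  rw [h3]; exact hw
end Hil
lemma an_fourier_pow (n : ℕ) (t : UnitAddCircle) :
    fourier (n : ℤ) t = (fourier 1 t : ℂ) ^ n := by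
  induction n with
  | zero => simp
  | succ n ih => rw [Nat.cast_succ, fourier_add, ih, pow_succ]

lemma an_inner (m n : ℤ) : inner ℂ (fourierLp (T := 1) 2 m) (fourierLp (T := 1) 2 n)
    = if m = n then (1:ℂ) else 0 := 
  orthonormal_iff_ite.1 (orthonormal_fourier (T := 1)) m n

lemma an_r (x u : ℕ → ℝ) (B : ℝ) (hB : ∀ n, |x n| ≤ B) (C : ℝ)
    (hC : ∀ z : ℂ, ‖z‖ < 1 → ‖∑' n, z ^ n * (x n : ℂ)‖ ≤ C) (N : ℕ) (r : ℝ) (h0 : 0 ≤ r)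
    (h1 : r < 1) :
    ∑ n ∈ Finset.range N, (∑ k ∈ Finset.range (n+1), (r ^ k * x k) * u (n-k)) ^ 2 ≤
      C ^ 2 * ∑ n ∈ Finset.range N, u n ^ 2 := by
  have hC0 : 0 ≤ C := (norm_nonneg _).trans (hC 0 (by simp))
  set y : ℕ → ℂ := fun n => ((r ^ n * x n : ℝ) : ℂ) with hy
  have hys : Summable fun n => ‖y n‖ := by
    refine Summable.of_nonneg_of_le (fun _ => norm_nonneg _) (fun n => ?_)
      ((summable_geometric_of_lt_one h0 h1).mul_right B)
    rw [hy]
    simp only [Complex.norm_real, Real.norm_eq_abs, abs_mul, abs_pow, abs_of_nonneg h0]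
    have := hB n
    gcongr
  have hFs : Summable fun n : ℕ => y n • (fourier (n:ℤ) : C(UnitAddCircle, ℂ)) := by
    refine Summable.of_norm ?_
    simpa [norm_smul, fourier_norm] using hys
  set F : C(UnitAddCircle, ℂ) := ∑' n : ℕ, y n • (fourier (n:ℤ) : C(UnitAddCircle, ℂ)) with hF
  have hFb : ∀ t, ‖F t‖ ≤ C := by
    intro t
    have : F t = ∑' n : ℕ, ((r:ℂ) * fourier 1 t) ^ n * (x n : ℂ) := by
      have h := (hFs.hasSum.map (ContinuousMap.evalCLM ℂ t) 
        (ContinuousMap.evalCLM ℂ t).continuous).tsum_eq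
      rw [← hF] at h
      change _ = F t at h
      rw [← h]
      refine tsum_congr fun n => ?_
      simp only [Function.comp, ContinuousMap.evalCLM_apply, ContinuousMap.smul_apply, 
        an_fourier_pow, hy]
      push_cast
      rw [smul_eq_mul]; ring
    rw [this]
    apply hC
    rw [norm_mul, fourier_apply, Circle.norm_coe, mul_one, Complex.norm_real, Real.norm_eq_abs, abs_of_nonneg h0]
    exact h1
  set p : C(UnitAddCircle, ℂ) := ∑ k ∈ Finset.range N, (u k : ℂ) • (fourier (k:ℤ) : C(UnitAddCircle, ℂ)) with hp
  let Λ := ContinuousMap.toLp (E := ℂ) 2 (AddCircle.haarAddCircle (T := 1)) ℂ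
  have hΛ : ∀ n : ℤ, Λ (fourier n) = fourierLp 2 n := fun n => rfl
  have hnp : ‖Λ p‖ ^ 2 = ∑ n ∈ Finset.range N, u n ^ 2 := by
    have e : Λ p = ∑ k ∈ Finset.range N, (u k : ℂ) • (fourierLp (T := 1) 2 ((k:ℕ):ℤ)) := by
      rw [hp, map_sum]; simp [hΛ]
    have ho : Orthonormal ℂ (fun k : ℕ => fourierLp (T := 1) 2 ((k:ℕ):ℤ)) :=
      orthonormal_fourier.comp _ Nat.cast_injective
    have h := ho.inner_sum (fun k => (u k : ℂ)) (fun k => (u k : ℂ)) (Finset.range N)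
    rw [← e, inner_self_eq_norm_sq_to_K] at h
    simp only [Complex.conj_ofReal] at h
    have h' : ((‖Λ p‖ ^ 2 : ℝ) : ℂ) = ((∑ n ∈ Finset.range N, u n ^ 2 : ℝ) : ℂ) := by
      push_cast
      simp only [sq (_ : ℂ)] at h ⊢
      exact h
    exact_mod_cast h'
  have hle : ‖Λ (F * p)‖ ≤ C * ‖Λ p‖ := by
    refine Lp.norm_le_mul_norm_of_ae_le_mul ?_
    filter_upwards [ContinuousMap.coeFn_toLp (p := 2) (𝕜 := ℂ) (AddCircle.haarAddCircle (T := 1)) (F * p), 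
      ContinuousMap.coeFn_toLp (p := 2) (𝕜 := ℂ) (AddCircle.haarAddCircle (T := 1)) p] with t h1 h2
    rw [h1, h2, ContinuousMap.mul_apply, norm_mul]
    gcongr
    exact hFb t
  have hin : ∀ m ∈ Finset.range N, inner ℂ (fourierLp (T := 1) 2 ((m:ℕ):ℤ)) (Λ (F * p))
      = ((∑ k ∈ Finset.range (m+1), (r ^ k * x k) * u (m-k) : ℝ) : ℂ) := by
    intro m hm
    have hs := (hFs.hasSum.mul_right p)
    rw [← hF] at hs
    have hs2 := hs.map ((innerSL ℂ (fourierLp (T := 1) 2 ((m:ℕ):ℤ))).comp Λ) 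
      (ContinuousLinearMap.continuous _)
    have hs3 : HasSum (fun n : ℕ => if n ∈ Finset.range (m+1) then y n * u (m - n) else 0)
      (inner ℂ (fourierLp (T := 1) 2 ((m:ℕ):ℤ)) (Λ (F * p))) := by
      convert hs2 using 1
      swap
      · rfl
      funext n
      have e1 : y n • (fourier (n:ℤ) : C(UnitAddCircle, ℂ)) * p = 
        ∑ k ∈ Finset.range N, (y n * u k) • (fourier ((n + k : ℕ):ℤ) : C(UnitAddCircle, ℂ)) := by
        rw [hp, Finset.mul_sum]
        refine Finset.sum_congr rfl fun k _ => ?_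
        ext t
        simp
        ring
      simp only [Function.comp]
      rw [e1, map_sum]
      simp only [map_smul, ContinuousLinearMap.comp_apply, hΛ, innerSL_apply_apply, an_inner, smul_eq_mul]
      split_ifs with hn
      · have hn' : n ≤ m := by simpa [Nat.lt_succ_iff] using hn
        rw [Finset.sum_eq_single (m - n)]
        · rw [if_pos (by omega), mul_one]
        · intro b _ hb
          rw [if_neg (by omega), mul_zero]
        · intro h
          exfalso; simp at h hm; omega
      · symm
        refine Finset.sum_eq_zero fun k _ => ?_
        rw [if_neg, mul_zero]
        simp at hn; omega
    have hs4 := hasSum_sum_of_ne_finset_zero (L := .unconditional ℕ) (f := fun n : ℕ => if n ∈ Finset.range (m+1) then y n * (u (m - n) : ℂ) else 0) (s := Finset.range (m+1)) (by intro b hb; exact if_neg hb)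
    rw [hs3.unique hs4]
    push_cast
    refine Finset.sum_congr rfl fun k hk => ?_
    rw [if_pos hk, hy]; push_cast; rfl
  have ho : Orthonormal ℂ (fun k : ℕ => fourierLp (T := 1) 2 ((k:ℕ):ℤ)) :=
      orthonormal_fourier.comp _ Nat.cast_injective
  have hb := ho.sum_inner_products_le (Λ (F * p)) (s := Finset.range N)
  rw [← hnp, ← mul_pow]
  refine le_trans (le_of_eq ?_) (hb.trans ?_)
  · refine Finset.sum_congr rfl fun m hm => ?_
    rw [hin m hm, Complex.norm_real, Real.norm_eq_abs, sq_abs]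
  · gcongr

lemma an_main (x u : ℕ → ℝ) (B : ℝ) (hB : ∀ n, |x n| ≤ B) (C : ℝ)
    (hC : ∀ z : ℂ, ‖z‖ < 1 → ‖∑' n, z ^ n * (x n : ℂ)‖ ≤ C) (N : ℕ) :
    ∑ n ∈ Finset.range N, (∑ k ∈ Finset.range (n+1), x k * u (n-k)) ^ 2 ≤
      C ^ 2 * ∑ n ∈ Finset.range N, u n ^ 2 := by
  have hc : Continuous fun r : ℝ => 
    ∑ n ∈ Finset.range N, (∑ k ∈ Finset.range (n+1), (r ^ k * x k) * u (n-k)) ^ 2 := by fun_prop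
  have ht := (hc.tendsto 1).mono_left (nhdsWithin_le_nhds (s := Set.Iio 1))
  simp only [one_pow, one_mul] at ht
  refine le_of_tendsto ht ?_
  filter_upwards [Ioo_mem_nhdsLT (show (0:ℝ) < 1 by norm_num)] with r hr
  exact an_r x u B hB C hC N r hr.1.le hr.2

/-! real power series -/
open PowerSeries in
noncomputable def ps_E (a : PowerSeries ℝ) : ℝ≥0∞ := ∑' n, (‖PowerSeries.coeff n a‖₊ : ℝ≥0∞) ^ 2

def ps_LM (a : PowerSeries ℝ) : Prop := ∃ C : NNReal, ∀ u, ps_E (a * u) ≤ C * ps_E u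

lemma sq_add_aux {R : Type*} [SeminormedAddCommGroup R] (x y : R) : 
    (‖x + y‖₊ : ℝ≥0∞) ^ 2 ≤ 2 * (‖x‖₊ : ℝ≥0∞) ^ 2 + 2 * (‖y‖₊ : ℝ≥0∞) ^ 2 := by
  have : ‖x + y‖₊ ^ 2 ≤ 2 * ‖x‖₊ ^ 2 + 2 * ‖y‖₊ ^ 2 := by
    rw [← NNReal.coe_le_coe]
    push_cast
    have := norm_add_le x y
    nlinarith [norm_nonneg x, norm_nonneg y, norm_nonneg (x+y), sq_nonneg (‖x‖ - ‖y‖)]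
  exact_mod_cast this

lemma ps_E_add (a b : PowerSeries ℝ) : ps_E (a + b) ≤ 2 * ps_E a + 2 * ps_E b := by
  unfold ps_E
  rw [← ENNReal.tsum_mul_left, ← ENNReal.tsum_mul_left, ← ENNReal.tsum_add]
  refine ENNReal.tsum_le_tsum fun n => ?_
  rw [map_add]
  exact sq_add_aux _ _

lemma ps_E_neg (a : PowerSeries ℝ) : ps_E (-a) = ps_E a := by
  unfold ps_E; simp

lemma ps_E_sub (a b : PowerSeries ℝ) : ps_E (a - b) ≤ 2 * ps_E a + 2 * ps_E b := by
  rw [sub_eq_add_neg]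
  refine (ps_E_add _ _).trans ?_
  rw [ps_E_neg]

lemma ps_E_C (c : ℝ) (a : PowerSeries ℝ) : ps_E (PowerSeries.C c * a) = ‖c‖₊ ^ 2 * ps_E a := by
  unfold ps_E
  rw [← ENNReal.tsum_mul_left]
  refine tsum_congr fun n => ?_
  rw [PowerSeries.coeff_C_mul, nnnorm_mul]
  push_cast
  ring

lemma ps_E_X (a : PowerSeries ℝ) : ps_E (PowerSeries.X * a) = ps_E a := by
  unfold ps_E
  rw [tsum_eq_zero_add' ENNReal.summable]
  simp [PowerSeries.coeff_succ_X_mul]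

lemma ps_E_one : ps_E 1 = 1 := by
  unfold ps_E
  rw [tsum_eq_single 0]
  · simp
  · intro n hn
    simp [PowerSeries.coeff_one, hn]

lemma ps_LM.add {a b : PowerSeries ℝ} (ha : ps_LM a) (hb : ps_LM b) : ps_LM (a + b) := by
  obtain ⟨A, hA⟩ := ha
  obtain ⟨B, hB⟩ := hb
  refine ⟨2 * A + 2 * B, fun u => ?_⟩
  rw [add_mul]
  refine (ps_E_add _ _).trans ?_
  push_cast
  rw [add_mul, mul_assoc, mul_assoc]
  gcongr
  · exact hA u
  · exact hB u

lemma ps_LM.mul {a b : PowerSeries ℝ} (ha : ps_LM a) (hb : ps_LM b) : ps_LM (a * b) := by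
  obtain ⟨A, hA⟩ := ha
  obtain ⟨B, hB⟩ := hb
  refine ⟨A * B, fun u => ?_⟩
  rw [mul_assoc]
  refine (hA _).trans ?_
  push_cast
  rw [mul_assoc]
  gcongr
  exact hB u

lemma ps_LM_C (c : ℝ) : ps_LM (PowerSeries.C c) :=
  ⟨‖c‖₊ ^ 2, fun u => by rw [ps_E_C]; push_cast; rfl⟩

lemma ps_LM_one : ps_LM 1 := by simpa using ps_LM_C 1

lemma ps_LM_zero : ps_LM 0 := by simpa using ps_LM_C 0

lemma ps_LM_X : ps_LM PowerSeries.X := ⟨1, fun u => by rw [ps_E_X]; simp⟩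

lemma ps_LM.neg {a : PowerSeries ℝ} (ha : ps_LM a) : ps_LM (-a) := by
  obtain ⟨A, hA⟩ := ha
  exact ⟨A, fun u => by rw [neg_mul, ps_E_neg]; exact hA u⟩

lemma ps_LM.sub {a b : PowerSeries ℝ} (ha : ps_LM a) (hb : ps_LM b) : ps_LM (a - b) := by
  rw [sub_eq_add_neg]; exact ha.add hb.neg

lemma ps_LM_poly (p : Polynomial ℝ) : ps_LM (p : PowerSeries ℝ) := by
  induction p using Polynomial.induction_on' with
  | add p q hp hq => rw [Polynomial.coe_add]; exact hp.add hq
  | monomial n c =>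
    rw [← Polynomial.C_mul_X_pow_eq_monomial, Polynomial.coe_mul, Polynomial.coe_C, Polynomial.coe_pow, Polynomial.coe_X]
    refine (ps_LM_C c).mul ?_
    induction n with
    | zero => simpa using ps_LM_one
    | succ n ih => rw [pow_succ]; exact ih.mul ps_LM_X

lemma ps_LM.lt_top {a : PowerSeries ℝ} (ha : ps_LM a) : ps_E a < ∞ := by
  obtain ⟨A, hA⟩ := ha
  have := hA 1
  rw [mul_one, ps_E_one, mul_one] at this
  exact this.trans_lt ENNReal.coe_lt_top

lemma ps_LM_of (x : ℕ → ℝ) (B : ℝ) (hB : ∀ n, |x n| ≤ B) (C : ℝ)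
    (hC : ∀ z : ℂ, ‖z‖ < 1 → ‖∑' n, z ^ n * (x n : ℂ)‖ ≤ C) : ps_LM (PowerSeries.mk x) := by
  refine ⟨C.toNNReal ^ 2, fun u => ?_⟩
  have hC0 : 0 ≤ C := (norm_nonneg _).trans (hC 0 (by simp))
  unfold ps_E
  rw [ENNReal.tsum_eq_iSup_nat]
  refine iSup_le fun N => ?_
  have h := an_main x (fun n => PowerSeries.coeff n u) B hB C hC N
  have e : ∀ n, PowerSeries.coeff n (PowerSeries.mk x * u) =
      ∑ k ∈ Finset.range (n+1), x k * PowerSeries.coeff (n-k) u := by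
    intro n
    rw [PowerSeries.coeff_mul, Finset.Nat.sum_antidiagonal_eq_sum_range_succ_mk]
    simp
  simp only [← e] at h
  have h2 : ∑ n ∈ Finset.range N, ‖PowerSeries.coeff n (PowerSeries.mk x * u)‖₊ ^ 2 ≤
      C.toNNReal ^ 2 * ∑ n ∈ Finset.range N, ‖PowerSeries.coeff n u‖₊ ^ 2 := by
    rw [← NNReal.coe_le_coe]
    push_cast
    simpa [hC0] using h
  refine le_trans (b := ((C.toNNReal ^ 2 * ∑ n ∈ Finset.range N, ‖PowerSeries.coeff n u‖₊ ^ 2 : NNReal) : ℝ≥0∞)) ?_ ?_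
  · exact_mod_cast h2
  · push_cast
    gcongr
    exact ENNReal.sum_le_tsum _

/-! the Hilbert space -/
abbrev HH := lp (fun _ : ℕ => ℝ) 2

noncomputable def hh_PS (x : HH) : PowerSeries ℝ := PowerSeries.mk (fun n => x n)

lemma hh_mem {a : PowerSeries ℝ} (h : ps_E a < ∞) : Memℓp (fun n => PowerSeries.coeff n a) 2 := by
  rw [memℓp_gen_iff (by norm_num)]
  have h1 : (∑' n, ((‖PowerSeries.coeff n a‖₊ ^ 2 : NNReal) : ℝ≥0∞)) ≠ ∞ := by
    have := h.ne
    unfold ps_E at this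
    push_cast
    exact this
  rw [ENNReal.tsum_coe_ne_top_iff_summable] at h1
  have h2 := NNReal.summable_coe.2 h1
  simpa using h2

noncomputable def hh_of (a : PowerSeries ℝ) (h : ps_E a < ∞) : HH := ⟨fun n => PowerSeries.coeff n a, hh_mem h⟩

lemma hh_PS_of (a : PowerSeries ℝ) (h : ps_E a < ∞) : hh_PS (hh_of a h) = a := by
  ext n; simp [hh_PS, hh_of]

lemma hh_PS_inj {x y : HH} (h : hh_PS x = hh_PS y) : x = y := by
  ext n
  have := congrArg (PowerSeries.coeff n) h
  simpa [hh_PS] using this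

lemma hh_sq (x : HH) : ∑' n, (x n) ^ 2 = ‖x‖ ^ 2 := by
  have := lp.norm_rpow_eq_tsum (p := 2) (by norm_num) x
  simpa using this.symm

lemma hh_summable (x : HH) : Summable fun n => (x n) ^ 2 := by
  have := (memℓp_gen_iff (p := 2) (by norm_num)).1 x.2
  simpa using this

lemma hh_E (x : HH) : ps_E (hh_PS x) = ENNReal.ofReal (‖x‖ ^ 2) := by
  rw [← hh_sq, ENNReal.ofReal_tsum_of_nonneg (fun _ => sq_nonneg _) (hh_summable x)]
  unfold ps_E hh_PS
  refine tsum_congr fun n => ?_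
  rw [PowerSeries.coeff_mk, ← sq_abs, ENNReal.ofReal_pow (abs_nonneg _), ← Real.norm_eq_abs, ofReal_norm]
  rfl

lemma hh_PS_add (x y : HH) : hh_PS (x + y) = hh_PS x + hh_PS y := by
  ext n; simp [hh_PS]

lemma hh_PS_smul (c : ℝ) (x : HH) : hh_PS (c • x) = PowerSeries.C c * hh_PS x := by
  ext n; simp [hh_PS]

lemma hh_fin (x : HH) : ps_E (hh_PS x) < ∞ := by rw [hh_E]; exact ENNReal.ofReal_lt_top

lemma ps_LM.fin {b : PowerSeries ℝ} (hb : ps_LM b) (x : HH) : ps_E (b * hh_PS x) < ∞ := by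
  obtain ⟨C, hC⟩ := hb
  exact (hC _).trans_lt (ENNReal.mul_lt_top ENNReal.coe_lt_top (hh_fin x))

noncomputable def hh_T0 (b : PowerSeries ℝ) (hb : ps_LM b) : HH →ₗ[ℝ] HH where
  toFun x := hh_of (b * hh_PS x) (hb.fin x)
  map_add' x y := hh_PS_inj ((hh_PS_of _ _).trans (by rw [hh_PS_add (hh_of _ _), hh_PS_of, hh_PS_of, hh_PS_add, mul_add]))
  map_smul' c x := hh_PS_inj ((hh_PS_of _ _).trans (by
    rw [RingHom.id_apply, hh_PS_smul c (hh_of _ _), hh_PS_of, hh_PS_smul]; ring))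

lemma hh_T0_PS (b : PowerSeries ℝ) (hb : ps_LM b) (x : HH) : hh_PS (hh_T0 b hb x) = b * hh_PS x :=
  hh_PS_of _ (hb.fin x)

lemma hh_T0_cont (b : PowerSeries ℝ) (hb : ps_LM b) : Continuous (hh_T0 b hb) := by
  obtain ⟨C, hC⟩ := id hb
  refine AddMonoidHomClass.continuous_of_bound (hh_T0 b hb) (Real.sqrt C) fun x => ?_
  have h := hC (hh_PS x)
  rw [← hh_T0_PS b hb, hh_E, hh_E, ← ENNReal.ofReal_coe_nnreal, ← ENNReal.ofReal_mul C.coe_nonneg,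
    ENNReal.ofReal_le_ofReal_iff (mul_nonneg C.coe_nonneg (by positivity))] at h
  refine le_of_sq_le_sq ?_ (by positivity)
  rw [mul_pow, Real.sq_sqrt C.coe_nonneg]
  exact h

noncomputable def hh_S : HH →ₗᵢ[ℝ] HH where
  toLinearMap := hh_T0 PowerSeries.X ps_LM_X
  norm_map' x := by
    have h := ps_E_X (hh_PS x)
    rw [← hh_T0_PS _ ps_LM_X, hh_E, hh_E, ENNReal.ofReal_eq_ofReal_iff (by positivity) (by positivity)] at h
    exact (sq_eq_sq₀ (norm_nonneg _) (norm_nonneg _)).1 h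

lemma hh_S_PS (x : HH) : hh_PS (hh_S x) = PowerSeries.X * hh_PS x := hh_T0_PS _ ps_LM_X x

lemma hh_S_iter (n : ℕ) (x : HH) : hh_PS (hh_S^[n] x) = PowerSeries.X ^ n * hh_PS x := by
  induction n with
  | zero => simp
  | succ n ih => rw [Function.iterate_succ_apply', hh_S_PS, ih, pow_succ]; ring

lemma hh_single (n : ℕ) (c : ℝ) : hh_PS (lp.single 2 n c) = PowerSeries.C c * PowerSeries.X ^ n := by
  ext m
  simp [hh_PS, PowerSeries.coeff_X_pow, Pi.single_apply]

lemma hh_hasSum (b : PowerSeries ℝ) (hb : ps_LM b) (x : HH) :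
    HasSum (fun j => x j • hh_S^[j] (hh_of b hb.lt_top)) (hh_T0 b hb x) := by
  have h := (lp.hasSum_single (p := 2) (by norm_num) x).map (hh_T0 b hb) (hh_T0_cont b hb)
  convert h using 1
  funext j
  apply hh_PS_inj
  rw [Function.comp, hh_T0_PS, hh_single, hh_PS_smul, hh_S_iter, hh_PS_of]
  ring

/-- the real approximation lemma -/
lemma ps_main (φ : PowerSeries ℝ) (hφ : ps_LM φ)
    (hyp : ∀ ε : ℝ≥0∞, 0 < ε → ∃ ψ, ps_LM ψ ∧ ∃ d : Fin 4 → PowerSeries ℝ,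
      (∀ i, ps_LM (d i) ∧ ps_E (d i) < ε) ∧ φ * ψ = 1 + 2 * d 0 + ∑ i, d i ^ 2) :
    ∀ ε : ℝ≥0∞, 0 < ε → ∃ p : Polynomial ℝ, ps_E (φ * p - 1) < ε := by
  have one_lt : ps_E 1 < ∞ := by rw [ps_E_one]; simp
  set Φ := hh_of φ hφ.lt_top with hΦ
  have hmem : hh_of 1 one_lt ∈ (Submodule.span ℝ (Set.range fun j : ℕ => hh_S^[j] Φ)).topologicalClosure := by
    refine hil_main hh_S _ ?_ Φ _ rfl ?_
    · intro x
      rw [lp.inner_eq_tsum]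
      have : ∀ n, inner ℝ ((hh_S x) n) ((hh_of 1 one_lt) n) = (0:ℝ) := by
        intro n
        have h1 : (hh_S x) n = PowerSeries.coeff n (PowerSeries.X * hh_PS x) := rfl
        have h2 : (hh_of 1 one_lt) n = PowerSeries.coeff n 1 := rfl
        rw [h1, h2]
        cases n <;> simp [PowerSeries.coeff_one]
      simp only [this, tsum_zero]
    · intro ε hε
      obtain ⟨ψ, hψ, d, hd, heq⟩ := hyp (ENNReal.ofReal (ε ^ 2)) (by simp; positivity)
      refine ⟨hh_T0 φ hφ (hh_of ψ hψ.lt_top), ?_, fun i => hh_of (d i) (hd i).1.lt_top, 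
        fun i => hh_T0 (d i) (hd i).1 (hh_of (d i) (hd i).1.lt_top), 
        fun i j => PowerSeries.coeff j (d i), ?_, ?_, ?_, ?_⟩
      · refine mem_closure_of_tendsto (hh_hasSum φ hφ (hh_of ψ hψ.lt_top)) (Eventually.of_forall fun s => ?_)
        refine Submodule.sum_mem _ fun j _ => Submodule.smul_mem _ _ (Submodule.subset_span ⟨j, rfl⟩)
      · intro i
        have h := (hd i).2
        rw [← hh_PS_of (d i) (hd i).1.lt_top, hh_E, ENNReal.ofReal_lt_ofReal_iff (by positivity)] at h
        exact lt_of_pow_lt_pow_left₀ 2 hε.le h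
      · intro i
        exact hh_hasSum (d i) (hd i).1 _
      · intro i s
        rw [← hh_sq]
        exact (hh_summable (hh_of (d i) (hd i).1.lt_top)).sum_le_tsum s (fun _ _ => sq_nonneg _)
      · apply hh_PS_inj
        have : ∀ (f : Fin 4 → HH), hh_PS (∑ i, f i) = ∑ i, hh_PS (f i) := by
          intro f; simp [Fin.sum_univ_four, hh_PS_add]
        rw [hh_T0_PS, hh_PS_add, hh_PS_add, hh_PS_smul, this, hh_PS_of, hh_PS_of, hh_PS_of]
        simp only [hh_T0_PS, hh_PS_of]
        rw [heq, show PowerSeries.C (2:ℝ) = 2 from map_ofNat _ 2]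
        simp only [sq]
  intro ε hε
  have hspan : ∀ y ∈ Submodule.span ℝ (Set.range fun j : ℕ => hh_S^[j] Φ), 
      ∃ p : Polynomial ℝ, hh_PS y = φ * p := by
    intro y hy
    induction hy using Submodule.span_induction with
    | mem y h =>
      obtain ⟨j, rfl⟩ := h
      refine ⟨Polynomial.X ^ j, ?_⟩
      simp only
      rw [hh_S_iter, hΦ, hh_PS_of]
      simp [mul_comm]
    | zero => exact ⟨0, by ext; simp [hh_PS]⟩
    | add y z _ _ h1 h2 =>
      obtain ⟨p, hp⟩ := h1
      obtain ⟨q, hq⟩ := h2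
      exact ⟨p + q, by rw [hh_PS_add, hp, hq]; simp [mul_add]⟩
    | smul c y _ h =>
      obtain ⟨p, hp⟩ := h
      exact ⟨Polynomial.C c * p, by rw [hh_PS_smul, hp]; simp; ring⟩
  have hlim : Tendsto (fun y : HH => ENNReal.ofReal (‖y - hh_of 1 one_lt‖ ^ 2)) (𝓝 (hh_of 1 one_lt)) (𝓝 0) := by
    have : Continuous (fun y : HH => ENNReal.ofReal (‖y - hh_of 1 one_lt‖ ^ 2)) := 
      ENNReal.continuous_ofReal.comp (by fun_prop)
    simpa using this.tendsto (hh_of 1 one_lt)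
  have hev := hlim.eventually (gt_mem_nhds hε)
  obtain ⟨y, hy1, hy2⟩ := mem_closure_iff_nhds.1 hmem _ hev
  obtain ⟨p, hp⟩ := hspan y hy2
  refine ⟨p, ?_⟩
  have e : φ * p - 1 = hh_PS (y - hh_of 1 one_lt) := by
    have := hh_PS_add (y - hh_of 1 one_lt) (hh_of 1 one_lt)
    rw [sub_add_cancel, hp, hh_PS_of] at this
    rw [this]; ring
  rw [e, hh_E]
  exact hy1

/-! quaternionic part -/

noncomputable def qs_th (a : ℕ → Quaternion ℝ) : Quaternion (PowerSeries ℝ) :=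
  ⟨PowerSeries.mk fun n => (a n).re, PowerSeries.mk fun n => (a n).imI,
   PowerSeries.mk fun n => (a n).imJ, PowerSeries.mk fun n => (a n).imK⟩

lemma qs_ext {p q : Quaternion (PowerSeries ℝ)} (h0 : p.re = q.re) (h1 : p.imI = q.imI)
    (h2 : p.imJ = q.imJ) (h3 : p.imK = q.imK) : p = q := by
  exact QuaternionAlgebra.ext h0 h1 h2 h3

lemma qs_sum {ι : Type*} (s : Finset ι) (F : ι → Quaternion ℝ) :
    (∑ i ∈ s, F i).re = ∑ i ∈ s, (F i).re ∧ (∑ i ∈ s, F i).imI = ∑ i ∈ s, (F i).imI ∧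
    (∑ i ∈ s, F i).imJ = ∑ i ∈ s, (F i).imJ ∧ (∑ i ∈ s, F i).imK = ∑ i ∈ s, (F i).imK := by
  induction s using Finset.induction_on with
  | empty => exact ⟨rfl, rfl, rfl, rfl⟩
  | insert a s ha ih => simp [Finset.sum_insert ha, ih]

lemma qs_th_mul (a b : ℕ → Quaternion ℝ) : qs_th (sProd a b) = qs_th a * qs_th b := by
  apply qs_ext
  all_goals
    ext n
    simp only [Quaternion.re_mul, Quaternion.imI_mul, Quaternion.imJ_mul, Quaternion.imK_mul,
      map_add, map_sub, PowerSeries.coeff_mul, Finset.Nat.sum_antidiagonal_eq_sum_range_succ_mk]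
    simp only [qs_th, PowerSeries.coeff_mk, sProd, qs_sum, Quaternion.re_mul, Quaternion.imI_mul,
      Quaternion.imJ_mul, Quaternion.imK_mul, Finset.sum_add_distrib, Finset.sum_sub_distrib]

lemma qs_th_inj {a b : ℕ → Quaternion ℝ} (h : qs_th a = qs_th b) : a = b := by
  funext n
  have h0 := congrArg (fun q : Quaternion (PowerSeries ℝ) => PowerSeries.coeff n q.re) h
  have h1 := congrArg (fun q : Quaternion (PowerSeries ℝ) => PowerSeries.coeff n q.imI) h
  have h2 := congrArg (fun q : Quaternion (PowerSeries ℝ) => PowerSeries.coeff n q.imJ) h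
  have h3 := congrArg (fun q : Quaternion (PowerSeries ℝ) => PowerSeries.coeff n q.imK) h
  simp only [qs_th, PowerSeries.coeff_mk] at h0 h1 h2 h3
  exact QuaternionAlgebra.ext h0 h1 h2 h3

lemma qs_th_sub (a b : ℕ → Quaternion ℝ) : qs_th (a - b) = qs_th a - qs_th b := by
  apply qs_ext <;> ext n
  · rw [Quaternion.re_sub, map_sub]; simp only [qs_th, PowerSeries.coeff_mk]; rfl
  · rw [Quaternion.imI_sub, map_sub]; simp only [qs_th, PowerSeries.coeff_mk]; rfl
  · rw [Quaternion.imJ_sub, map_sub]; simp only [qs_th, PowerSeries.coeff_mk]; rfl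
  · rw [Quaternion.imK_sub, map_sub]; simp only [qs_th, PowerSeries.coeff_mk]; rfl

lemma qs_assoc (a b c : ℕ → Quaternion ℝ) : sProd (sProd a b) c = sProd a (sProd b c) :=
  qs_th_inj (by simp only [qs_th_mul, mul_assoc])

lemma qs_mul_sub (a b c : ℕ → Quaternion ℝ) : sProd a (b - c) = sProd a b - sProd a c :=
  qs_th_inj (by simp only [qs_th_mul, qs_th_sub, mul_sub])

lemma qs_th_conj (a : ℕ → Quaternion ℝ) : qs_th (conjS a) = star (qs_th a) := by
  apply qs_ext <;> ext n
  · rw [Quaternion.re_star]; simp only [qs_th, PowerSeries.coeff_mk, conjS, Quaternion.re_star]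
  · rw [Quaternion.imI_star, map_neg]; simp only [qs_th, PowerSeries.coeff_mk, conjS, Quaternion.imI_star]
  · rw [Quaternion.imJ_star, map_neg]; simp only [qs_th, PowerSeries.coeff_mk, conjS, Quaternion.imJ_star]
  · rw [Quaternion.imK_star, map_neg]; simp only [qs_th, PowerSeries.coeff_mk, conjS, Quaternion.imK_star]

lemma qs_th_one : qs_th oneS = 1 := by
  apply qs_ext <;> ext n
  · rw [Quaternion.re_one]
    simp only [qs_th, PowerSeries.coeff_mk, oneS, constS, PowerSeries.coeff_one]
    split_ifs <;> rfl
  · rw [Quaternion.imI_one, map_zero]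
    simp only [qs_th, PowerSeries.coeff_mk, oneS, constS]
    split_ifs <;> rfl
  · rw [Quaternion.imJ_one, map_zero]
    simp only [qs_th, PowerSeries.coeff_mk, oneS, constS]
    split_ifs <;> rfl
  · rw [Quaternion.imK_one, map_zero]
    simp only [qs_th, PowerSeries.coeff_mk, oneS, constS]
    split_ifs <;> rfl

noncomputable def qs_nsq (a : ℕ → Quaternion ℝ) : ℝ≥0∞ := ∑' n, (‖a n‖₊ : ℝ≥0∞) ^ 2

lemma qs_dist (a b : ℕ → Quaternion ℝ) : h2distSq a b = qs_nsq (a - b) := rfl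

lemma qs_mem (a : ℕ → Quaternion ℝ) : MemH2 a ↔ qs_nsq a < ∞ := by
  have : qs_nsq a = ∑' n, ((‖a n‖₊ ^ 2 : NNReal) : ℝ≥0∞) := by unfold qs_nsq; push_cast; rfl
  rw [this, lt_top_iff_ne_top, ENNReal.tsum_coe_ne_top_iff_summable, ← NNReal.summable_coe]
  unfold MemH2
  simp

lemma qs_nsq_add (a b : ℕ → Quaternion ℝ) : qs_nsq (a + b) ≤ 2 * qs_nsq a + 2 * qs_nsq b := by
  unfold qs_nsq
  rw [← ENNReal.tsum_mul_left, ← ENNReal.tsum_mul_left, ← ENNReal.tsum_add]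
  exact ENNReal.tsum_le_tsum fun n => sq_add_aux _ _

lemma qs_nsq_tri (a b c : ℕ → Quaternion ℝ) :
    qs_nsq (a - c) ≤ 2 * qs_nsq (a - b) + 2 * qs_nsq (b - c) := by
  have := qs_nsq_add (a - b) (b - c)
  rwa [sub_add_sub_cancel] at this

lemma qs_nsq_comm (a b : ℕ → Quaternion ℝ) : qs_nsq (a - b) = qs_nsq (b - a) := by
  unfold qs_nsq
  refine tsum_congr fun n => ?_
  rw [Pi.sub_apply, Pi.sub_apply, ← nnnorm_neg, neg_sub]

noncomputable def qs_QE (q : Quaternion (PowerSeries ℝ)) : ℝ≥0∞ :=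
  ps_E q.re + ps_E q.imI + ps_E q.imJ + ps_E q.imK

lemma qs_nsq_eq (a : ℕ → Quaternion ℝ) : qs_nsq a = qs_QE (qs_th a) := by
  unfold qs_nsq qs_QE ps_E
  rw [← ENNReal.tsum_add, ← ENNReal.tsum_add, ← ENNReal.tsum_add]
  refine tsum_congr fun n => ?_
  have : ‖a n‖₊ ^ 2 = ‖(a n).re‖₊ ^ 2 + ‖(a n).imI‖₊ ^ 2 + ‖(a n).imJ‖₊ ^ 2 + ‖(a n).imK‖₊ ^ 2 := by
    rw [← NNReal.coe_inj]
    push_cast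
    rw [sq ‖a n‖, ← Quaternion.normSq_eq_norm_mul_self, Quaternion.normSq_def']
    simp
  simp only [qs_th, PowerSeries.coeff_mk]
  exact_mod_cast this

def qs_CMQ (q : Quaternion (PowerSeries ℝ)) : Prop :=
  ps_LM q.re ∧ ps_LM q.imI ∧ ps_LM q.imJ ∧ ps_LM q.imK

lemma ps_E_four {a b c d : PowerSeries ℝ} {K : ℝ≥0∞} (ha : ps_E a ≤ K) (hb : ps_E b ≤ K)
    (hc : ps_E c ≤ K) (hd : ps_E d ≤ K) : ps_E (a + b + c + d) ≤ 22 * K := by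
  calc ps_E (a + b + c + d) ≤ 2 * (2 * (2 * ps_E a + 2 * ps_E b) + 2 * ps_E c) + 2 * ps_E d := by
        refine (ps_E_add _ _).trans ?_
        gcongr
        refine (ps_E_add _ _).trans ?_
        gcongr
        exact ps_E_add _ _
    _ ≤ 2 * (2 * (2 * K + 2 * K) + 2 * K) + 2 * K := by gcongr
    _ = 22 * K := by ring

lemma qs_CMQ.bound {a : Quaternion (PowerSeries ℝ)} (ha : qs_CMQ a) :
    ∃ C : NNReal, ∀ u, qs_QE (a * u) ≤ C * qs_QE u := by
  obtain ⟨⟨A, hA⟩, ⟨B, hB⟩, ⟨C, hC⟩, ⟨D, hD⟩⟩ := ha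
  refine ⟨88 * (A + B + C + D), fun u => ?_⟩
  set K : ℝ≥0∞ := (A + B + C + D) * qs_QE u with hK
  have u0 : ps_E u.re ≤ qs_QE u := by unfold qs_QE; simp only [add_assoc]; exact le_self_add
  have u1 : ps_E u.imI ≤ qs_QE u := by
    unfold qs_QE; simp only [add_assoc]; exact le_self_add.trans le_add_self
  have u2 : ps_E u.imJ ≤ qs_QE u := by
    unfold qs_QE; exact le_add_self.trans le_self_add
  have u3 : ps_E u.imK ≤ qs_QE u := by unfold qs_QE; exact le_add_self
  have a0 : (A : ℝ≥0∞) ≤ A + B + C + D := by simp only [add_assoc]; exact le_self_add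
  have a1 : (B : ℝ≥0∞) ≤ A + B + C + D := by simp only [add_assoc]; exact le_self_add.trans le_add_self
  have a2 : (C : ℝ≥0∞) ≤ A + B + C + D := le_add_self.trans le_self_add
  have a3 : (D : ℝ≥0∞) ≤ A + B + C + D := le_add_self
  have k0 : ∀ v, ps_E v ≤ qs_QE u → ps_E (a.re * v) ≤ K := fun v hv => (hA v).trans (mul_le_mul' a0 hv)
  have k1 : ∀ v, ps_E v ≤ qs_QE u → ps_E (a.imI * v) ≤ K := fun v hv => (hB v).trans (mul_le_mul' a1 hv)
  have k2 : ∀ v, ps_E v ≤ qs_QE u → ps_E (a.imJ * v) ≤ K := fun v hv => (hC v).trans (mul_le_mul' a2 hv)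
  have k3 : ∀ v, ps_E v ≤ qs_QE u → ps_E (a.imK * v) ≤ K := fun v hv => (hD v).trans (mul_le_mul' a3 hv)
  have e0 : ps_E (a * u).re ≤ 22 * K := by
    rw [Quaternion.re_mul, sub_eq_add_neg, sub_eq_add_neg, sub_eq_add_neg]
    apply ps_E_four <;> simp only [ps_E_neg, k0, k1, k2, k3, u0, u1, u2, u3]
  have e1 : ps_E (a * u).imI ≤ 22 * K := by
    rw [Quaternion.imI_mul, sub_eq_add_neg]
    apply ps_E_four <;> simp only [ps_E_neg, k0, k1, k2, k3, u0, u1, u2, u3]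
  have e2 : ps_E (a * u).imJ ≤ 22 * K := by
    rw [Quaternion.imJ_mul, sub_eq_add_neg]
    apply ps_E_four <;> simp only [ps_E_neg, k0, k1, k2, k3, u0, u1, u2, u3]
  have e3 : ps_E (a * u).imK ≤ 22 * K := by
    rw [Quaternion.imK_mul, sub_eq_add_neg]
    apply ps_E_four <;> simp only [ps_E_neg, k0, k1, k2, k3, u0, u1, u2, u3]
  calc qs_QE (a * u) ≤ 22 * K + 22 * K + 22 * K + 22 * K := by
        unfold qs_QE; gcongr
    _ = 88 * K := by ring
    _ = _ := by rw [hK]; push_cast; ring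

lemma qs_CMQ.mul {a b : Quaternion (PowerSeries ℝ)} (ha : qs_CMQ a) (hb : qs_CMQ b) :
    qs_CMQ (a * b) := by
  obtain ⟨a0, a1, a2, a3⟩ := ha
  obtain ⟨b0, b1, b2, b3⟩ := hb
  refine ⟨?_, ?_, ?_, ?_⟩
  · rw [Quaternion.re_mul]
    exact (((a0.mul b0).sub (a1.mul b1)).sub (a2.mul b2)).sub (a3.mul b3)
  · rw [Quaternion.imI_mul]
    exact (((a0.mul b1).add (a1.mul b0)).add (a2.mul b3)).sub (a3.mul b2)
  · rw [Quaternion.imJ_mul, sub_eq_add_neg]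
    exact (((a0.mul b2).add (a1.mul b3).neg).add (a2.mul b0)).add (a3.mul b1)
  · rw [Quaternion.imK_mul]
    exact (((a0.mul b3).add (a1.mul b2)).sub (a2.mul b1)).add (a3.mul b0)

lemma qs_CMQ.star {a : Quaternion (PowerSeries ℝ)} (ha : qs_CMQ a) : qs_CMQ (star a) := by
  obtain ⟨a0, a1, a2, a3⟩ := ha
  exact ⟨by simpa using a0, by simpa using a1.neg, by simpa using a2.neg, by simpa using a3.neg⟩

lemma qs_CMQ.normSq {a : Quaternion (PowerSeries ℝ)} (ha : qs_CMQ a) :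
    ps_LM (Quaternion.normSq a) := by
  obtain ⟨a0, a1, a2, a3⟩ := ha
  rw [Quaternion.normSq_def']
  simp only [sq]
  exact (((a0.mul a0).add (a1.mul a1)).add (a2.mul a2)).add (a3.mul a3)

def qs_CM (a : ℕ → Quaternion ℝ) : Prop := qs_CMQ (qs_th a)

lemma qs_CM.mul {a b : ℕ → Quaternion ℝ} (ha : qs_CM a) (hb : qs_CM b) : qs_CM (sProd a b) := by
  unfold qs_CM; rw [qs_th_mul]; exact qs_CMQ.mul ha hb

lemma qs_CM.conj {a : ℕ → Quaternion ℝ} (ha : qs_CM a) : qs_CM (conjS a) := by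
  unfold qs_CM; rw [qs_th_conj]; exact qs_CMQ.star ha

lemma qs_CM.bound {a : ℕ → Quaternion ℝ} (ha : qs_CM a) :
    ∃ C : NNReal, ∀ u, qs_nsq (sProd a u) ≤ C * qs_nsq u := by
  obtain ⟨C, hC⟩ := qs_CMQ.bound ha
  refine ⟨C, fun u => ?_⟩
  rw [qs_nsq_eq, qs_nsq_eq, qs_th_mul]
  exact hC _

lemma qs_CM.fin {a : ℕ → Quaternion ℝ} (ha : qs_CM a) : qs_nsq a < ∞ := by
  rw [qs_nsq_eq]
  obtain ⟨a0, a1, a2, a3⟩ := ha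
  unfold qs_QE
  simp only [ENNReal.add_lt_top]
  exact ⟨⟨⟨a0.lt_top, a1.lt_top⟩, a2.lt_top⟩, a3.lt_top⟩

lemma ps_LM_mk (x : ℕ → ℝ) (N : ℕ) (h : ∀ n > N, x n = 0) : ps_LM (PowerSeries.mk x) := by
  have : PowerSeries.mk x = ((PowerSeries.trunc (N+1) (PowerSeries.mk x) : Polynomial ℝ) : PowerSeries ℝ) := by
    ext n
    rw [Polynomial.coeff_coe, PowerSeries.coeff_trunc, PowerSeries.coeff_mk]
    split_ifs with hn
    · rfl
    · exact h n (by omega)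
  rw [this]
  exact ps_LM_poly _

lemma qs_CM_poly {p : ℕ → Quaternion ℝ} (hp : IsPolyQ p) : qs_CM p := by
  obtain ⟨N, hN⟩ := hp
  exact ⟨ps_LM_mk (fun n => (p n).re) N fun n hn => by
      change (p n).re = 0; rw [hN n hn]; exact Quaternion.re_zero,
    ps_LM_mk (fun n => (p n).imI) N fun n hn => by
      change (p n).imI = 0; rw [hN n hn]; exact Quaternion.imI_zero,
    ps_LM_mk (fun n => (p n).imJ) N fun n hn => by
      change (p n).imJ = 0; rw [hN n hn]; exact Quaternion.imJ_zero,
    ps_LM_mk (fun n => (p n).imK) N fun n hn => by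
      change (p n).imK = 0; rw [hN n hn]; exact Quaternion.imK_zero⟩

noncomputable def qs_re (x : ℕ → ℝ) : ℕ → Quaternion ℝ := fun n => (x n : Quaternion ℝ)

lemma qs_th_re (x : ℕ → ℝ) : qs_th (qs_re x) = ((PowerSeries.mk x : PowerSeries ℝ) : Quaternion (PowerSeries ℝ)) := by
  apply qs_ext <;> ext n
  · rw [Quaternion.re_coe]; simp only [qs_th, PowerSeries.coeff_mk, qs_re, Quaternion.re_coe]
  · rw [Quaternion.imI_coe, map_zero]; simp only [qs_th, PowerSeries.coeff_mk, qs_re, Quaternion.imI_coe]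
  · rw [Quaternion.imJ_coe, map_zero]; simp only [qs_th, PowerSeries.coeff_mk, qs_re, Quaternion.imJ_coe]
  · rw [Quaternion.imK_coe, map_zero]; simp only [qs_th, PowerSeries.coeff_mk, qs_re, Quaternion.imK_coe]

/-! `H^∞` functions are multipliers -/

lemma hi_bdd {a : ℕ → Quaternion ℝ} (ha : MemH2 a) : ∃ B, ∀ n, ‖a n‖ ≤ B := by
  have h : Summable fun n => ‖a n‖ ^ 2 := ha
  refine ⟨Real.sqrt (∑' n, ‖a n‖ ^ 2), fun n => ?_⟩
  refine Real.le_sqrt_of_sq_le ?_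
  exact h.le_tsum n fun _ _ => sq_nonneg _

lemma hi_sum {a : ℕ → Quaternion ℝ} (ha : MemH2 a) {q : Quaternion ℝ} (hq : q ∈ QBall) :
    Summable fun n => q ^ n * a n := by
  obtain ⟨B, hB⟩ := hi_bdd ha
  have hq' : ‖q‖ < 1 := hq
  refine Summable.of_norm_bounded ((summable_geometric_of_lt_one (norm_nonneg q) hq').mul_right B) fun n => ?_
  rw [norm_mul, norm_pow]
  have := hB n
  gcongr

lemma hi_add {a b : ℕ → Quaternion ℝ} (ha : MemHinf a) (hb : MemHinf b) : MemHinf (a + b) := by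
  obtain ⟨ha, A, hA⟩ := ha
  obtain ⟨hb, B, hB⟩ := hb
  refine ⟨?_, A + B, fun q hq => ?_⟩
  · rw [qs_mem] at *
    refine (qs_nsq_add a b).trans_lt ?_
    rw [ENNReal.add_lt_top]
    exact ⟨ENNReal.mul_lt_top (by simp) ha, ENNReal.mul_lt_top (by simp) hb⟩
  · have : evalS (a + b) q = evalS a q + evalS b q := by
      unfold evalS
      rw [← (hi_sum ha hq).tsum_add (hi_sum hb hq)]
      simp [mul_add]
    rw [this]
    exact (norm_add_le _ _).trans (add_le_add (hA q hq) (hB q hq))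

lemma hi_right {a : ℕ → Quaternion ℝ} (ha : MemHinf a) (e : Quaternion ℝ) :
    MemHinf (fun n => a n * e) := by
  obtain ⟨ha, A, hA⟩ := ha
  refine ⟨?_, A * ‖e‖, fun q hq => ?_⟩
  · unfold MemH2 at *
    simp only [norm_mul, mul_pow]
    exact ha.mul_right _
  · have : evalS (fun n => a n * e) q = evalS a q * e := by
      unfold evalS
      rw [← (hi_sum ha hq).tsum_mul_right]
      simp [mul_assoc]
    rw [this, norm_mul]
    have := hA q hq
    gcongr

lemma hi_conj_pow (q e : Quaternion ℝ) (he : e ≠ 0) (n : ℕ) : q ^ n * e = e * (e⁻¹ * q * e) ^ n := by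
  induction n with
  | zero => simp
  | succ n ih =>
    rw [pow_succ (e⁻¹ * q * e), ← mul_assoc e, ← ih, pow_succ]
    simp only [mul_assoc]
    rw [← mul_assoc e, mul_inv_cancel₀ he, one_mul]

lemma hi_left {a : ℕ → Quaternion ℝ} (ha : MemHinf a) (e : Quaternion ℝ) (he : e ≠ 0) :
    MemHinf (fun n => e * a n) := by
  obtain ⟨ha, A, hA⟩ := ha
  refine ⟨?_, ‖e‖ * A, fun q hq => ?_⟩
  · unfold MemH2 at *
    simp only [norm_mul, mul_pow]
    exact ha.mul_left _
  · have hq' : e⁻¹ * q * e ∈ QBall := by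
      have h1 : ‖q‖ < 1 := hq
      change ‖_‖ < 1
      rw [norm_mul, norm_mul, norm_inv, mul_comm, ← mul_assoc, mul_inv_cancel₀ (by simpa using he), one_mul]
      exact h1
    have : evalS (fun n => e * a n) q = e * evalS a (e⁻¹ * q * e) := by
      unfold evalS
      rw [← (hi_sum ha hq').tsum_mul_left]
      refine tsum_congr fun n => ?_
      rw [← mul_assoc, hi_conj_pow q e he, mul_assoc]
    rw [this, norm_mul]
    have := hA _ hq'
    gcongr

lemma hi_norm_complex (z : ℂ) : ‖(z : Quaternion ℝ)‖ = ‖z‖ := by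
  have h1 := Quaternion.normSq_eq_norm_mul_self (z : Quaternion ℝ)
  rw [Quaternion.normSq_def'] at h1
  have h2 := Complex.normSq_eq_norm_sq z
  rw [Complex.normSq_apply] at h2
  simp at h1
  refine (sq_eq_sq₀ (norm_nonneg _) (norm_nonneg _)).1 ?_
  rw [← h2, sq ‖(z : Quaternion ℝ)‖, ← h1]; ring

lemma hi_real {x : ℕ → ℝ} (hx : MemHinf (qs_re x)) : ps_LM (PowerSeries.mk x) := by
  obtain ⟨h2, C, hC⟩ := hx
  obtain ⟨B, hB⟩ := hi_bdd h2
  have hB' : ∀ n, |x n| ≤ B := by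
    intro n
    have := hB n
    simpa [qs_re] using this
  refine ps_LM_of x B hB' C fun z hz => ?_
  have hs : Summable fun n => z ^ n * (x n : ℂ) := by
    refine Summable.of_norm_bounded ((summable_geometric_of_lt_one (norm_nonneg z) hz).mul_right B) fun n => ?_
    rw [norm_mul, norm_pow, Complex.norm_real, Real.norm_eq_abs]
    have := hB' n
    gcongr
  have hcont : Continuous Quaternion.ofComplex := 
    AddMonoidHomClass.continuous_of_bound Quaternion.ofComplex 1 (fun z => by
      rw [one_mul]; exact (hi_norm_complex z).le)
  have hm := (hs.hasSum.map Quaternion.ofComplex hcont).tsum_eq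
  rw [← hi_norm_complex]
  change ‖Quaternion.ofComplex _‖ ≤ C
  rw [← hm]
  have hq : (z : Quaternion ℝ) ∈ QBall := by
    change ‖_‖ < 1
    rw [hi_norm_complex]; exact hz
  have := hC _ hq
  unfold evalS at this
  convert this using 3
  funext n
  simp [qs_re]
  left
  exact map_pow Quaternion.ofComplex z n

lemma hi_re {a : ℕ → Quaternion ℝ} (ha : MemHinf a) : ps_LM (PowerSeries.mk fun n => (a n).re) := by
  obtain ⟨i, i0, i1, i2, i3⟩ : ∃ i : Quaternion ℝ, i.re = 0 ∧ i.imI = 1 ∧ i.imJ = 0 ∧ i.imK = 0 :=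
    ⟨⟨0, 1, 0, 0⟩, rfl, rfl, rfl, rfl⟩
  obtain ⟨j, j0, j1, j2, j3⟩ : ∃ i : Quaternion ℝ, i.re = 0 ∧ i.imI = 0 ∧ i.imJ = 1 ∧ i.imK = 0 :=
    ⟨⟨0, 0, 1, 0⟩, rfl, rfl, rfl, rfl⟩
  obtain ⟨k, k0, k1, k2, k3⟩ : ∃ i : Quaternion ℝ, i.re = 0 ∧ i.imI = 0 ∧ i.imJ = 0 ∧ i.imK = 1 :=
    ⟨⟨0, 0, 0, 1⟩, rfl, rfl, rfl, rfl⟩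
  have hi : i ≠ 0 := fun h => by rw [h, Quaternion.imI_zero] at i1; exact zero_ne_one i1
  have hj : j ≠ 0 := fun h => by rw [h, Quaternion.imJ_zero] at j2; exact zero_ne_one j2
  have hk : k ≠ 0 := fun h => by rw [h, Quaternion.imK_zero] at k3; exact zero_ne_one k3
  have h := hi_add (hi_add (hi_add (hi_right ha (1/4 : ℝ)) (hi_right (hi_left ha i hi) ((-1/4 : ℝ) * i)))
    (hi_right (hi_left ha j hj) ((-1/4 : ℝ) * j))) (hi_right (hi_left ha k hk) ((-1/4 : ℝ) * k))
  apply hi_real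
  convert h using 1
  funext n
  simp only [qs_re, Pi.add_apply]
  apply QuaternionAlgebra.ext <;>
    simp only [Quaternion.re_mul, Quaternion.imI_mul, Quaternion.imJ_mul, Quaternion.imK_mul,
      Quaternion.re_add, Quaternion.imI_add, Quaternion.imJ_add, Quaternion.imK_add,
      Quaternion.re_coe, Quaternion.imI_coe, Quaternion.imJ_coe, Quaternion.imK_coe,
      i0, i1, i2, i3, j0, j1, j2, j3, k0, k1, k2, k3] <;> ring

lemma hi_CM {a : ℕ → Quaternion ℝ} (ha : MemHinf a) : qs_CM a := by
  obtain ⟨i, i0, i1, i2, i3⟩ : ∃ i : Quaternion ℝ, i.re = 0 ∧ i.imI = 1 ∧ i.imJ = 0 ∧ i.imK = 0 :=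
    ⟨⟨0, 1, 0, 0⟩, rfl, rfl, rfl, rfl⟩
  obtain ⟨j, j0, j1, j2, j3⟩ : ∃ i : Quaternion ℝ, i.re = 0 ∧ i.imI = 0 ∧ i.imJ = 1 ∧ i.imK = 0 :=
    ⟨⟨0, 0, 1, 0⟩, rfl, rfl, rfl, rfl⟩
  obtain ⟨k, k0, k1, k2, k3⟩ : ∃ i : Quaternion ℝ, i.re = 0 ∧ i.imI = 0 ∧ i.imJ = 0 ∧ i.imK = 1 :=
    ⟨⟨0, 0, 0, 1⟩, rfl, rfl, rfl, rfl⟩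
  have h1 := (hi_re (hi_right ha i)).neg
  have h2 := (hi_re (hi_right ha j)).neg
  have h3 := (hi_re (hi_right ha k)).neg
  refine ⟨hi_re ha, ?_, ?_, ?_⟩
  · convert h1 using 1; ext n; simp [qs_th, Quaternion.re_mul, i0, i1, i2, i3]
  · convert h2 using 1; ext n; simp [qs_th, Quaternion.re_mul, j0, j1, j2, j3]
  · convert h3 using 1; ext n; simp [qs_th, Quaternion.re_mul, k0, k1, k2, k3]

/-! approximation -/

def qs_Appr (g h : ℕ → Quaternion ℝ) : Prop :=
  ∀ ε : ℝ≥0∞, 0 < ε → ∃ p, IsPolyQ p ∧ qs_nsq (sProd g p - h) < ε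

lemma qs_cyc (g : ℕ → Quaternion ℝ) :
    IsCyclicQ g ↔ qs_nsq g < ∞ ∧ ∀ h, qs_nsq h < ∞ → qs_Appr g h := by
  unfold IsCyclicQ InvSub qs_Appr
  simp only [qs_mem, qs_dist, Set.mem_setOf_eq]
  constructor
  · rintro ⟨h1, h2⟩
    exact ⟨h1, fun h hh => (h2 h hh).2⟩
  · rintro ⟨h1, h2⟩
    exact ⟨h1, fun h hh => ⟨hh, h2 h hh⟩⟩

lemma qs_delta (C : NNReal) (ε : ℝ≥0∞) (hε : 0 < ε) : ∃ δ : ℝ≥0∞, 0 < δ ∧ C * δ < ε := by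
  have hc : Continuous fun δ : ℝ≥0∞ => (C : ℝ≥0∞) * δ := ENNReal.continuous_const_mul (by simp)
  have ht := (hc.tendsto 0).mono_left (nhdsWithin_le_nhds (s := Set.Ioi 0))
  rw [mul_zero] at ht
  obtain ⟨δ, h1, h2⟩ := ((ht.eventually (gt_mem_nhds hε)).and self_mem_nhdsWithin).exists
  exact ⟨δ, h2, h1⟩

lemma qs_poly_dense (h : ℕ → Quaternion ℝ) (hh : qs_nsq h < ∞) (ε : ℝ≥0∞) (hε : 0 < ε) :
    ∃ p, IsPolyQ p ∧ qs_nsq (p - h) < ε := by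
  have ht := ENNReal.tendsto_tsum_compl_atTop_zero (f := fun n => (‖h n‖₊ : ℝ≥0∞) ^ 2) hh.ne
  obtain ⟨s, hs⟩ := (ht.eventually (gt_mem_nhds hε)).exists
  refine ⟨fun n => if n ∈ s then h n else 0, ⟨s.sup id, fun n hn => ?_⟩, ?_⟩
  · refine if_neg fun hns => ?_
    have := Finset.le_sup (f := id) hns
    simp only [id] at this
    omega
  · refine lt_of_le_of_lt (le_of_eq ?_) hs
    unfold qs_nsq
    refine Eq.trans ?_ (tsum_subtype {n : ℕ | n ∉ s} (fun n => (‖h n‖₊ : ℝ≥0∞) ^ 2)).symm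
    refine tsum_congr fun n => ?_
    by_cases hn : n ∈ s
    · rw [Set.indicator_of_notMem (by simpa using hn)]
      simp [hn]
    · rw [Set.indicator_of_mem (by simpa using hn)]
      simp [hn]

lemma qs_A1 {g y : ℕ → Quaternion ℝ} (hg : qs_CM g) (hy : qs_nsq y < ∞) : qs_Appr g (sProd g y) := by
  intro ε hε
  obtain ⟨C, hC⟩ := hg.bound
  obtain ⟨δ, hδ, h⟩ := qs_delta C ε hε
  obtain ⟨p, hp, hp2⟩ := qs_poly_dense y hy δ hδ
  refine ⟨p, hp, ?_⟩
  rw [← qs_mul_sub]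
  refine (hC _).trans_lt (lt_of_le_of_lt ?_ h)
  gcongr

lemma qs_A2 {g h : ℕ → Quaternion ℝ}
    (H : ∀ ε : ℝ≥0∞, 0 < ε → ∃ h', qs_Appr g h' ∧ qs_nsq (h' - h) < ε) : qs_Appr g h := by
  intro ε hε
  obtain ⟨δ, hδ, hlt⟩ := qs_delta 4 ε hε
  obtain ⟨h', h1, h2⟩ := H δ hδ
  obtain ⟨p, hp, hp2⟩ := h1 δ hδ
  refine ⟨p, hp, (qs_nsq_tri _ h' _).trans_lt (lt_of_le_of_lt ?_ hlt)⟩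
  calc _ ≤ 2 * δ + 2 * δ := by gcongr
    _ = _ := by push_cast; ring

lemma qs_key {f g : ℕ → Quaternion ℝ} (hf : qs_CM f) (hg : qs_CM g)
    (hfg : ∀ h, qs_nsq h < ∞ → qs_Appr (sProd f g) h) (ε : ℝ≥0∞) (hε : 0 < ε) :
    ∃ p : Polynomial ℝ, ps_E (Quaternion.normSq (qs_th g) * p - 1) < ε := by
  refine ps_main _ (qs_CMQ.normSq hg) ?_ ε hε
  intro ε hε
  have h1 : qs_nsq oneS < ∞ := (qs_CM_poly (p := oneS) ⟨0, fun n hn => if_neg (by omega)⟩).fin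
  obtain ⟨p, hp, hp2⟩ := hfg oneS h1 ε hε
  have hpc := qs_CM_poly hp
  refine ⟨Quaternion.normSq (qs_th f) * Quaternion.normSq (qs_th p), 
    (qs_CMQ.normSq hf).mul (qs_CMQ.normSq hpc), ?_⟩
  set m := qs_th f * qs_th g * qs_th p with hm
  have hmc : qs_CMQ m := (qs_CMQ.mul hf hg).mul hpc
  rw [qs_nsq_eq, qs_th_sub, qs_th_mul, qs_th_mul, ← hm, qs_th_one] at hp2
  have e0 : ps_E (m.re - 1) ≤ qs_QE (m - 1) := by
    unfold qs_QE; simp only [add_assoc]; exact le_self_add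
  have e1 : ps_E m.imI ≤ qs_QE (m - 1) := by
    have h : (m - 1).imI = m.imI := by rw [Quaternion.imI_sub, Quaternion.imI_one, sub_zero]
    unfold qs_QE; rw [h]; simp only [add_assoc]; exact le_self_add.trans le_add_self
  have e2 : ps_E m.imJ ≤ qs_QE (m - 1) := by
    have h : (m - 1).imJ = m.imJ := by rw [Quaternion.imJ_sub, Quaternion.imJ_one, sub_zero]
    unfold qs_QE; rw [h]; exact le_add_self.trans le_self_add
  have e3 : ps_E m.imK ≤ qs_QE (m - 1) := by
    have h : (m - 1).imK = m.imK := by rw [Quaternion.imK_sub, Quaternion.imK_one, sub_zero]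
    unfold qs_QE; rw [h]; exact le_add_self
  refine ⟨![m.re - 1, m.imI, m.imJ, m.imK], ?_, ?_⟩
  · obtain ⟨m0, m1, m2, m3⟩ := hmc
    intro i
    fin_cases i
    · exact ⟨m0.sub ps_LM_one, e0.trans_lt hp2⟩
    · exact ⟨m1, e1.trans_lt hp2⟩
    · exact ⟨m2, e2.trans_lt hp2⟩
    · exact ⟨m3, e3.trans_lt hp2⟩
  · have : Quaternion.normSq m = Quaternion.normSq (qs_th g) * 
        (Quaternion.normSq (qs_th f) * Quaternion.normSq (qs_th p)) := by
      rw [hm, map_mul, map_mul]; ring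
    rw [← this, Quaternion.normSq_def', Fin.sum_univ_four]
    simp
    ring

/-- For `f, g ∈ H^∞(𝔹)`, the product `f * g` is cyclic in `H²(𝔹)` if and only if both
`f` and `g` are cyclic in `H²(𝔹)`. -/
theorem prod_cyclic_iff (f g : ℕ → Quaternion ℝ) (hf : MemHinf f) (hg : MemHinf g) :
    IsCyclicQ (sProd f g) ↔ IsCyclicQ f ∧ IsCyclicQ g := by
  have hf' := hi_CM hf
  have hg' := hi_CM hg
  simp only [qs_cyc]
  constructor
  · rintro ⟨-, hfg⟩
    refine ⟨⟨hf'.fin, fun h hh => ?_⟩, ⟨hg'.fin, fun h hh => ?_⟩⟩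
    · refine qs_A2 fun ε hε => ?_
      obtain ⟨p, hp, hp2⟩ := hfg h hh ε hε
      refine ⟨_, ?_, hp2⟩
      rw [qs_assoc]
      exact qs_A1 hf' (hg'.mul (qs_CM_poly hp)).fin
    · refine qs_A2 fun ε hε => ?_
      obtain ⟨P, hP, hP2⟩ := qs_poly_dense h hh ε hε
      refine ⟨P, ?_, hP2⟩
      refine qs_A2 fun ε hε => ?_
      have hPc := qs_CM_poly hP
      obtain ⟨C, hC⟩ := hPc.bound
      obtain ⟨δ, hδ, hlt⟩ := qs_delta C ε hε
      obtain ⟨r, hr⟩ := qs_key hf' hg' hfg δ hδ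
      set R := qs_re (fun n => r.coeff n) with hR
      have hthR : qs_th R = ((r : PowerSeries ℝ) : Quaternion (PowerSeries ℝ)) := by
        rw [hR, qs_th_re]; rfl
      have hRc : qs_CM R := by
        unfold qs_CM; rw [hthR]
        exact ⟨by simpa using ps_LM_poly r, by simpa using ps_LM_zero, by simpa using ps_LM_zero,
          by simpa using ps_LM_zero⟩
      refine ⟨sProd g (sProd (conjS g) (sProd R P)), ?_, ?_⟩
      · exact qs_A1 hg' (hg'.conj.mul (hRc.mul hPc)).fin
      · set D := qs_re (fun n => PowerSeries.coeff n (Quaternion.normSq (qs_th g) * r - 1)) with hD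
        have hthD : qs_th D = ((Quaternion.normSq (qs_th g) * r - 1 : PowerSeries ℝ) : Quaternion (PowerSeries ℝ)) := by
          rw [hD, qs_th_re]; congr 1; ext n; simp
        have e : sProd g (sProd (conjS g) (sProd R P)) - P = sProd P D := by
          apply qs_th_inj
          rw [qs_th_sub, qs_th_mul, qs_th_mul, qs_th_mul, qs_th_mul, qs_th_conj, hthR, hthD,
            ← mul_assoc, Quaternion.self_mul_star, ← Quaternion.coe_commutes]
          push_cast
          rw [sub_mul, one_mul, mul_assoc]
        rw [e]
        refine (hC D).trans_lt (lt_of_le_of_lt ?_ hlt)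
        gcongr
        rw [qs_nsq_eq, hthD]
        unfold qs_QE
        have z : ps_E 0 = 0 := by simp [ps_E]
        simp only [Quaternion.re_coe, Quaternion.imI_coe, Quaternion.imJ_coe, Quaternion.imK_coe, z, add_zero]
        exact hr.le
  · rintro ⟨⟨-, hfc⟩, ⟨-, hgc⟩⟩
    refine ⟨(hf'.mul hg').fin, fun h hh => ?_⟩
    refine qs_A2 fun ε hε => ?_
    obtain ⟨p, hp, hp2⟩ := hfc h hh ε hε
    refine ⟨_, ?_, hp2⟩
    intro ε hε
    obtain ⟨C, hC⟩ := hf'.bound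
    obtain ⟨δ, hδ, hlt⟩ := qs_delta C ε hε
    obtain ⟨r, hr, hr2⟩ := hgc p (qs_CM_poly hp).fin δ hδ
    refine ⟨r, hr, ?_⟩
    rw [qs_assoc, ← qs_mul_sub]
    refine (hC _).trans_lt (lt_of_le_of_lt ?_ hlt)
    gcongr
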